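/- arXiv:1604.08768 — 6 statements merged into one kernel-verified Lean document; each statement's English description precedes it below -/
import Mathlib

section
/- Let G be a generator and K ⊆ L(G) a nonempty closed specification. There exists a supervisor V for G such that L(V/G) = K if and only if K is controllable in G. -/
open Classical

/-! ### Behaviors, systems, histories, traces (AI behavior composition) -/

/-- A behavior: a transition system with an initial state over actions `Act`. -/
structure Behavior (State : Type) (Act : Type) where
  init : State
  trans : State → Act → State → Prop

/-- A behavior is deterministic if successors are unique. -/
def Behavior.Deterministic {State Act : Type} (B : Behavior State Act) : Prop :=
  ∀ s a s' s'', B.trans s a s' → B.trans s a s'' → s' = s''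

/-- The initial state of the enacted system of `S = (B_1, ..., B_n)`. -/
def sysInit {n : ℕ} {SB Act : Type} (S : Fin n → Behavior SB Act) : Fin n → SB :=
  fun i => (S i).init

/-- Enacted-system transition `b −a,j→ b'`. -/
def sysTrans {n : ℕ} {SB Act : Type} (S : Fin n → Behavior SB Act)
    (b : Fin n → SB) (a : Act) (j : Fin n) (b' : Fin n → SB) : Prop :=
  (S j).trans (b j) a (b' j) ∧ ∀ i, i ≠ j → b i = b' i

/-- One step of a system history: action, delegated index, and resulting system state. -/
abbrev Step (SB Act : Type) (n : ℕ) := Act × Fin n × (Fin n → SB)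

/-- Last system state of a history (initial state for the empty history). -/
def lastState {n : ℕ} {SB Act : Type} (S : Fin n → Behavior SB Act)
    (h : List (Step SB Act n)) : Fin n → SB :=
  match h.getLast? with
  | none => sysInit S
  | some s => s.2.2

/-- `h` is a system history: a finite sequence of consecutive enacted-system
transitions starting from the initial system state. -/
inductive ValidHist {n : ℕ} {SB Act : Type} (S : Fin n → Behavior SB Act) :
    List (Step SB Act n) → Prop
  | nil : ValidHist S []
  | snoc {h : List (Step SB Act n)} {a : Act} {j : Fin n} {b : Fin n → SB} :
      ValidHist S h → sysTrans S (lastState S h) a j b → ValidHist S (h ++ [(a, j, b)])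

/-- A (finite or infinite) trace of a behavior `B`, starting at the initial state:
`acts i` is the (i+1)-st action, leading from `states i` to `states (i+1)`,
for all `i <` the length `len : ℕ∞`. -/
structure Trace {State Act : Type} (B : Behavior State Act) where
  len : ℕ∞
  states : ℕ → State
  acts : ℕ → Act
  init_eq : states 0 = B.init
  step : ∀ i : ℕ, (i : ℕ∞) < len → B.trans (states i) (acts i) (states (i + 1))

/-- The set `H_{P,τ}` of `(P,τ)`-induced system histories, for an
action-request controller `P`. -/
inductive Induced {n : ℕ} {SB ST Act : Type} (S : Fin n → Behavior SB Act)
    {T : Behavior ST Act} (P : List (Step SB Act n) → Act → Fin n) (τ : Trace T) :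
    List (Step SB Act n) → Prop
  | nil : Induced S P τ []
  | snoc {h : List (Step SB Act n)} {j : Fin n} {b : Fin n → SB} :
      Induced S P τ h → (h.length : ℕ∞) < τ.len →
      j = P h (τ.acts h.length) →
      sysTrans S (lastState S h) (τ.acts h.length) j b →
      Induced S P τ (h ++ [(τ.acts h.length, j, b)])

/-- `P` realizes the target trace `τ` in system `S`. -/
def Realizes {n : ℕ} {SB ST Act : Type} (S : Fin n → Behavior SB Act)
    {T : Behavior ST Act} (P : List (Step SB Act n) → Act → Fin n) (τ : Trace T) : Prop :=
  ∀ h, Induced S P τ h → (h.length : ℕ∞) < τ.len →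
    ∃ b', sysTrans S (lastState S h) (τ.acts h.length) (P h (τ.acts h.length)) b'

/-- `P` is an exact composition of the target `T` in system `S`. -/
def ExactComposition {n : ℕ} {SB ST Act : Type} (S : Fin n → Behavior SB Act)
    (T : Behavior ST Act) (P : List (Step SB Act n) → Act → Fin n) : Prop :=
  ∀ τ : Trace T, Realizes S P τ

/-- `R` is an nd-simulation of the target `T` by the enacted system of `S`. -/
def IsNDSim {n : ℕ} {SB ST Act : Type} (T : Behavior ST Act)
    (S : Fin n → Behavior SB Act) (R : ST → (Fin n → SB) → Prop) : Prop :=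
  ∀ t b, R t b → ∀ a t', T.trans t a t' →
    ∃ j : Fin n, (∃ b', sysTrans S b a j b') ∧ ∀ b', sysTrans S b a j b' → R t' b'

/-- `t ≼_ND b` : `(t,b)` belongs to some nd-simulation. -/
def NDSimulated {n : ℕ} {SB ST Act : Type} (T : Behavior ST Act)
    (S : Fin n → Behavior SB Act) (t : ST) (b : Fin n → SB) : Prop :=
  ∃ R, IsNDSim T S R ∧ R t b

/-! ### Generators and supervisory control -/

/-- A generator (deterministic automaton with partial transition function,
marked states, and a distinguished set of controllable events; the
uncontrollable events are the complement). -/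
structure Generator (E : Type) (Q : Type) where
  controllable : Set E
  init : Q
  step : Q → E → Option Q
  marked : Set Q

/-- Run a generator from a state on a word. -/
def Generator.runFrom {E Q : Type} (G : Generator E Q) : Q → List E → Option Q
  | q, [] => some q
  | q, σ :: w =>
    match G.step q σ with
    | none => none
    | some q' => G.runFrom q' w

/-- Run a generator from its initial state. -/
def Generator.run {E Q : Type} (G : Generator E Q) (w : List E) : Option Q :=
  G.runFrom G.init w

/-- The generated language `L(G)`. -/
def Generator.Lang {E Q : Type} (G : Generator E Q) : Set (List E) :=
  { w | (G.run w).isSome }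

/-- The marked language `Lm(G)`. -/
def Generator.MLang {E Q : Type} (G : Generator E Q) : Set (List E) :=
  { w | ∃ q, G.run w = some q ∧ q ∈ G.marked }

/-- Prefix closure of a language. -/
def cl {E : Type} (K : Set (List E)) : Set (List E) := { w | ∃ v, w ++ v ∈ K }

/-- A language is closed if it equals its prefix closure. -/
def IsClosedLang {E : Type} (K : Set (List E)) : Prop := K = cl K

/-- `K` is controllable in `G`: `cl(K)·Σu ∩ L(G) ⊆ cl(K)`. -/
def ControllableIn {E Q : Type} (G : Generator E Q) (K : Set (List E)) : Prop :=
  ∀ w σ, w ∈ cl K → σ ∉ G.controllable → w ++ [σ] ∈ G.Lang → w ++ [σ] ∈ cl K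

/-- A supervisor for `G`: enables a set of events after each generated word,
always including all uncontrollable events. -/
def IsSupervisor {E Q : Type} (G : Generator E Q) (V : List E → Set E) : Prop :=
  ∀ w ∈ G.Lang, ∀ σ, σ ∉ G.controllable → σ ∈ V w

/-- The controlled language `L(V/G)` (as an inductive predicate: the smallest
language containing ε and closed under enabled extensions). -/
inductive CtrlLang {E Q : Type} (G : Generator E Q) (V : List E → Set E) : List E → Prop
  | nil : CtrlLang G V []
  | snoc {w : List E} {σ : E} :
      CtrlLang G V w → w ++ [σ] ∈ G.Lang → σ ∈ V w → CtrlLang G V (w ++ [σ])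

/-- `L(V/G)` as a set. -/
def ctrlLang {E Q : Type} (G : Generator E Q) (V : List E → Set E) : Set (List E) :=
  { w | CtrlLang G V w }

/-- `Lm(V/G) = L(V/G) ∩ Lm(G)`. -/
def mCtrlLang {E Q : Type} (G : Generator E Q) (V : List E → Set E) : Set (List E) :=
  ctrlLang G V ∩ G.MLang

/-- `V` is nonblocking in `G`. -/
def Nonblocking {E Q : Type} (G : Generator E Q) (V : List E → Set E) : Prop :=
  ctrlLang G V = cl (mCtrlLang G V)

/-- The supremal controllable sublanguage of `K` in `G`: the union of all
controllable sublanguages of `K`. -/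
def supC {E Q : Type} (G : Generator E Q) (K : Set (List E)) : Set (List E) :=
  ⋃₀ { K' | K' ⊆ K ∧ ControllableIn G K' }

/-! ### The composition plant -/

/-- Events of the composition plant: target actions, behavior indexes, behavior states. -/
abbrev PlantEvent (SB Act : Type) (n : ℕ) := Act ⊕ (Fin n ⊕ SB)

/-- States of the composition plant: target state, system state, pending request
(`none` = `e`), pending delegation (`none` = `0`). -/
abbrev PlantState (SB ST Act : Type) (n : ℕ) :=
  ST × (Fin n → SB) × Option Act × Option (Fin n)

/-- The composition plant `G_{S,T}`. -/
noncomputable def compPlant {n : ℕ} {SB ST Act : Type}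
    (S : Fin n → Behavior SB Act) (T : Behavior ST Act) :
    Generator (PlantEvent SB Act n) (PlantState SB ST Act n) where
  controllable := { σ | ∃ j : Fin n, σ = Sum.inr (Sum.inl j) }
  init := (T.init, sysInit S, none, none)
  step := fun q σ =>
    match q.2.2.1, q.2.2.2, σ with
    | none, none, Sum.inl a =>
        if h : ∃ t', T.trans q.1 a t' then some (h.choose, q.2.1, some a, none) else none
    | some a, none, Sum.inr (Sum.inl j) => some (q.1, q.2.1, some a, some j)
    | some a, some j, Sum.inr (Sum.inr s) =>
        if (S j).trans (q.2.1 j) a s then some (q.1, Function.update q.2.1 j s, none, none)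
        else none
    | _, _, _ => none
  marked := { q | q.2.2.1 = none ∧ q.2.2.2 = none }

/-- The word of a system history: each step `(a, j, b)` contributes
`a · j · st_j(b)`. -/
def histWord {n : ℕ} {SB Act : Type} (h : List (Step SB Act n)) :
    List (PlantEvent SB Act n) :=
  h.foldr
    (fun s acc =>
      Sum.inl s.1 :: Sum.inr (Sum.inl s.2.1) :: Sum.inr (Sum.inr (s.2.2 s.2.1)) :: acc) []

/-- A controller `P` is induced by a supervisor `V` for the composition plant:
`P(h,σ) ∈ V(word(h)·σ)` for every system history `h` and action `σ`. -/
def InducedBySupervisor {n : ℕ} {SB Act : Type} (S : Fin n → Behavior SB Act)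
    (V : List (PlantEvent SB Act n) → Set (PlantEvent SB Act n))
    (P : List (Step SB Act n) → Act → Fin n) : Prop :=
  ∀ h, ValidHist S h → ∀ a : Act,
    Sum.inr (Sum.inl (P h a)) ∈ V (histWord h ++ [Sum.inl a])

/-- Words of shape `(A_t · Indx · Succ)*`. -/
inductive TriWord {n : ℕ} {SB Act : Type} : List (PlantEvent SB Act n) → Prop
  | nil : TriWord []
  | cons {a : Act} {j : Fin n} {s : SB} {w : List (PlantEvent SB Act n)} :
      TriWord w → TriWord (Sum.inl a :: Sum.inr (Sum.inl j) :: Sum.inr (Sum.inr s) :: w)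

/-- The selection function `ω` of the DES controller generator extracted from the
generator `R` (with `dec` decoding composition states from `R`-states):
`ω(q, σ)` is the set of indexes `j` such that some reachable `R`-state decoding
to `q` has an outgoing `σ·j·b'` run. -/
def cgOmega {n : ℕ} {SB ST Act Y : Type} (R : Generator (PlantEvent SB Act n) Y)
    (dec : Y → ST × (Fin n → SB)) (q : ST × (Fin n → SB)) (σ : Act) : Set (Fin n) :=
  { j | ∃ y s, (∃ p, TriWord p ∧ R.run p = some y) ∧ dec y = q ∧
      (R.runFrom y [Sum.inl σ, Sum.inr (Sum.inl j), Sum.inr (Sum.inr s)]).isSome }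

/-- A controller `P` is generated by the DES controller generator extracted
from `R`: all its delegations are allowed by `ω` at the decoded composition
state reached by the word of the current history. -/
def GeneratedBy {n : ℕ} {SB ST Act Y : Type} (S : Fin n → Behavior SB Act)
    (R : Generator (PlantEvent SB Act n) Y) (dec : Y → ST × (Fin n → SB))
    (P : List (Step SB Act n) → Act → Fin n) : Prop :=
  ∀ h, ValidHist S h → ∀ σ : Act, ∀ y, R.run (histWord h) = some y →
    P h σ ∈ cgOmega R dec (dec y) σ

/-! ### Simulation, RTFs and the maximal composition plant -/

/-- `B2 ≼ B1` : a simulation of `B2` by `B1` relating their initial states. -/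
def Simulates {S2 S1 Act : Type} (B2 : Behavior S2 Act) (B1 : Behavior S1 Act) : Prop :=
  ∃ R : S2 → S1 → Prop,
    (∀ s2 s1, R s2 s1 → ∀ a s2', B2.trans s2 a s2' → ∃ s1', B1.trans s1 a s1' ∧ R s2' s1') ∧
    R B2.init B1.init

/-- The induced histories `H_{P,τ}` for a transition-request controller `P`. -/
inductive TInduced {n : ℕ} {SB ST' Act : Type} (S : Fin n → Behavior SB Act)
    {T' : Behavior ST' Act} (P : List (Step SB Act n) → ST' × Act × ST' → Fin n)
    (τ : Trace T') : List (Step SB Act n) → Prop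
  | nil : TInduced S P τ []
  | snoc {h : List (Step SB Act n)} {j : Fin n} {b : Fin n → SB} :
      TInduced S P τ h → (h.length : ℕ∞) < τ.len →
      j = P h (τ.states h.length, τ.acts h.length, τ.states (h.length + 1)) →
      sysTrans S (lastState S h) (τ.acts h.length) j b →
      TInduced S P τ (h ++ [(τ.acts h.length, j, b)])

/-- A transition-request controller `P` realizes the trace `τ`. -/
def TRealizes {n : ℕ} {SB ST' Act : Type} (S : Fin n → Behavior SB Act)
    {T' : Behavior ST' Act} (P : List (Step SB Act n) → ST' × Act × ST' → Fin n)
    (τ : Trace T') : Prop :=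
  ∀ h, TInduced S P τ h → (h.length : ℕ∞) < τ.len →
    ∃ b', sysTrans S (lastState S h) (τ.acts h.length)
      (P h (τ.states h.length, τ.acts h.length, τ.states (h.length + 1))) b'

/-- `P` is an exact composition of the (possibly nondeterministic) target `T'`
in `S`, with transition requests. -/
def TExactComposition {n : ℕ} {SB ST' Act : Type} (S : Fin n → Behavior SB Act)
    (T' : Behavior ST' Act) (P : List (Step SB Act n) → ST' × Act × ST' → Fin n) : Prop :=
  ∀ τ : Trace T', TRealizes S P τ

/-- `T'` is a realizable target fragment (RTF) of `T` in `S`. -/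
def IsRTF {n : ℕ} {SB ST ST' Act : Type} (S : Fin n → Behavior SB Act)
    (T : Behavior ST Act) (T' : Behavior ST' Act) : Prop :=
  Simulates T' T ∧ ∃ P, TExactComposition S T' P

/-- `T'` is a supremal realizable target fragment (SRTF) of `T` in `S`. -/
def IsSRTF {n : ℕ} {SB ST ST' Act : Type} (S : Fin n → Behavior SB Act)
    (T : Behavior ST Act) (T' : Behavior ST' Act) : Prop :=
  IsRTF S T T' ∧ ∀ (ST'' : Type) (T'' : Behavior ST'' Act), IsRTF S T T'' →
    Simulates T' T'' → Simulates T'' T'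

/-- Events of the maximal composition plant: target transitions and behavior indexes. -/
abbrev MaxEvent (ST Act : Type) (n : ℕ) := (ST × Act × ST) ⊕ Fin n

/-- States of the maximal composition plant. -/
abbrev MaxState (SB ST Act : Type) (n : ℕ) := ST × (Fin n → SB) × Option (ST × Act × ST)

/-- The maximal composition plant `Ĝ_{S,T}` (for a deterministic system `S`);
all events are controllable. -/
noncomputable def maxPlant {n : ℕ} {SB ST Act : Type}
    (S : Fin n → Behavior SB Act) (T : Behavior ST Act) :
    Generator (MaxEvent ST Act n) (MaxState SB ST Act n) where
  controllable := Set.univ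
  init := (T.init, sysInit S, none)
  step := fun q σ =>
    match q.2.2, σ with
    | none, Sum.inl θ =>
        if T.trans θ.1 θ.2.1 θ.2.2 then some (q.1, q.2.1, some θ) else none
    | some θ, Sum.inr j =>
        if h : θ.1 = q.1 ∧ ∃ s', (S j).trans (q.2.1 j) θ.2.1 s' then
          some (θ.2.2, Function.update q.2.1 j h.2.choose, none)
        else none
    | _, _ => none
  marked := { q | q.2.2 = none }

/-- `MaxWordH T t h w tf` : `w` is the word `(θ1·j1)⋯(θℓ·jℓ)` of history `h`,
where `θi` is the transition of `T` on the i-th action of `h` from the `T`-state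
reached so far (starting at `t`), and `tf` is the final `T`-state reached. -/
inductive MaxWordH {n : ℕ} {SB ST Act : Type} (T : Behavior ST Act) :
    ST → List (Step SB Act n) → List (MaxEvent ST Act n) → ST → Prop
  | nil {t : ST} : MaxWordH T t [] [] t
  | cons {t t' tf : ST} {a : Act} {j : Fin n} {b : Fin n → SB}
      {rest : List (Step SB Act n)} {w : List (MaxEvent ST Act n)} :
      T.trans t a t' → MaxWordH T t' rest w tf →
      MaxWordH T t ((a, j, b) :: rest) (Sum.inl (t, a, t') :: Sum.inr j :: w) tf

/-- The extracted target `T*_{S,T}` from a generator `R` for `K̂↑`: states are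
`R`-states, with a transition on action `a` whenever `R` can run a request
`θ = (t,a,t') ∈ δ_t` followed by a delegation `j`. -/
def extractedTarget {n : ℕ} {ST Act Y : Type} (T : Behavior ST Act)
    (R : Generator (MaxEvent ST Act n) Y) : Behavior Y Act where
  init := R.init
  trans := fun y a y' => ∃ (t t' : ST) (j : Fin n),
    T.trans t a t' ∧ R.runFrom y [Sum.inl (t, a, t'), Sum.inr j] = some y'

/-- Controllability theorem: for a nonempty closed
specification `K ⊆ L(G)`, there is a supervisor `V` with `L(V/G) = K` iff `K`
is controllable in `G`. -/
theorem supervisor_exists_iff_controllable {E Q : Type} [Fintype E] [Fintype Q]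
    (G : Generator E Q) (K : Set (List E)) (hsub : K ⊆ G.Lang)
    (hne : K.Nonempty) (hclosed : IsClosedLang K) :
    (∃ V : List E → Set E, IsSupervisor G V ∧ ctrlLang G V = K) ↔
      ControllableIn G K := by
  have mem_cl {w : List E} : w ∈ cl K ↔ w ∈ K := Set.ext_iff.mp hclosed.symm w
  constructor
  · rintro ⟨V, hV, rfl⟩ w σ hw hσ hwσ
    have hw' := mem_cl.mp hw
    exact mem_cl.mpr (CtrlLang.snoc hw' hwσ (hV w (hsub hw') σ hσ))
  · intro hK
    refine ⟨fun w => { σ | σ ∉ G.controllable ∨ w ++ [σ] ∈ K },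
      fun w _ σ hσ => Or.inl hσ, Set.Subset.antisymm ?_ ?_⟩
    · intro w hw
      induction hw with
      | nil =>
        obtain ⟨v, hv⟩ := hne
        exact mem_cl.mp ⟨v, hv⟩
      | snoc _ hLang hV ih =>
        exact hV.elim (fun hσ => mem_cl.mp (hK _ _ (mem_cl.mpr ih) hσ hLang)) id
    · intro w hw
      induction w using List.reverseRecOn with
      | nil => exact CtrlLang.nil
      | append_singleton w σ ih =>
        exact CtrlLang.snoc (ih (mem_cl.mp ⟨[σ], hw⟩)) (hsub hw) (Or.inr hw)
end

section
/- For any generator G and any family (K_i) of languages each of which is a controllable sublanguage of a language K ⊆ L(G), the union ∪_i K_i is again a controllable sublanguage of K. Consequently supC(K), the union of all controllable sublanguages of K, is itself controllable in G and is the unique largest (with respect to set inclusion) controllable sublanguage of K. -/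
open Classical

/-- Prefix closure is monotone. -/
theorem cl_mono {E : Type} {K L : Set (List E)} (h : K ⊆ L) : cl K ⊆ cl L :=
  fun _ ⟨v, hv⟩ => ⟨v, h hv⟩

/-- A union of controllable languages is controllable. -/
theorem ControllableIn.sUnion {E Q : Type} {G : Generator E Q} {𝒦 : Set (Set (List E))}
    (h : ∀ K ∈ 𝒦, ControllableIn G K) : ControllableIn G (⋃₀ 𝒦) := by
  rintro w σ ⟨v, K, hK, hv⟩ hσ hw
  exact cl_mono (Set.subset_sUnion_of_mem hK) (h K hK w σ ⟨v, hv⟩ hσ hw)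

/-- controllable sublanguages of `K` are closed under
arbitrary unions; hence `supC(K)` is controllable and is the unique largest
controllable sublanguage of `K`. -/
theorem supC_is_supremal_controllable {E Q : Type} [Fintype E] [Fintype Q]
    (G : Generator E Q) (K : Set (List E)) (hK : K ⊆ G.Lang)
    {ι : Type} (Ki : ι → Set (List E))
    (hKi : ∀ i, Ki i ⊆ K ∧ ControllableIn G (Ki i)) :
    ((⋃ i, Ki i) ⊆ K ∧ ControllableIn G (⋃ i, Ki i)) ∧
    (supC G K ⊆ K ∧ ControllableIn G (supC G K)) ∧
    (∀ K', K' ⊆ K → ControllableIn G K' → K' ⊆ supC G K) ∧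
    (∀ M, M ⊆ K → ControllableIn G M →
      (∀ K', K' ⊆ K → ControllableIn G K' → K' ⊆ M) → M = supC G K) := by
  have hsub : supC G K ⊆ K := Set.sUnion_subset fun _ h => h.1
  have hctrl : ControllableIn G (supC G K) := ControllableIn.sUnion fun _ h => h.2
  have hmax : ∀ K', K' ⊆ K → ControllableIn G K' → K' ⊆ supC G K :=
    fun _ h h' => Set.subset_sUnion_of_mem ⟨h, h'⟩
  refine ⟨⟨Set.iUnion_subset fun i => (hKi i).1, ?_⟩, ⟨hsub, hctrl⟩, hmax, ?_⟩
  · rw [← Set.sUnion_range]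
    exact ControllableIn.sUnion (Set.forall_mem_range.2 fun i => (hKi i).2)
  · exact fun M hM hMc h => (hmax M hM hMc).antisymm (h _ hsub hctrl)
end

section
/- Let S be an available system, T a deterministic target behavior, and G_{S,T} the composition plant, and suppose K↑_{S,T} = supC(Lm(G_{S,T})) ≠ ∅. Then for every word w ∈ K↑_{S,T}, st_t(g) ≼_ND (st_1(g), ..., st_n(g)), where g = γ(g0, w) is the plant state reached by w, st_t(g) is the target component of g and st_i(g) is the i-th behavior component of g. -/
open Classical

theorem Generator.runFrom_append {E Q : Type} (G : Generator E Q) (q : Q) (u v : List E) :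
    G.runFrom q (u ++ v) = (G.runFrom q u).bind fun q' => G.runFrom q' v := by
  induction u generalizing q with
  | nil => rfl
  | cons σ u ih =>
    simp only [List.cons_append, Generator.runFrom]
    cases G.step q σ with
    | none => rfl
    | some q' => exact ih q'

theorem Generator.run_append_singleton {E Q : Type} (G : Generator E Q) {w : List E} {q : Q}
    (h : G.run w = some q) (σ : E) : G.run (w ++ [σ]) = G.step q σ := by
  unfold Generator.run at h ⊢
  rw [G.runFrom_append, h]
  simp only [Option.bind_some, Generator.runFrom]
  cases G.step q σ <;> rfl

/-- A prefix of a marked sublanguage that reaches an unmarked state can be extended by one event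
within the prefix closure. -/
theorem exists_append_mem_cl {E Q : Type} {G : Generator E Q} {K : Set (List E)}
    (hK : K ⊆ G.MLang) {w : List E} {q : Q} (hw : w ∈ cl K) (hq : G.run w = some q)
    (hm : q ∉ G.marked) : ∃ σ q', w ++ [σ] ∈ cl K ∧ G.step q σ = some q' := by
  obtain ⟨v, hv⟩ := hw
  obtain ⟨r, hr, hrm⟩ := hK hv
  cases v with
  | nil =>
    rw [List.append_nil, hq, Option.some.injEq] at hr
    exact absurd (hr ▸ hrm) hm
  | cons σ v =>
    have hs : w ++ [σ] ++ v ∈ K := by simpa using hv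
    cases h : G.step q σ with
    | some q' => exact ⟨σ, q', ⟨v, hs⟩, h⟩
    | none =>
      unfold Generator.run at hr hq
      rw [G.runFrom_append, hq] at hr
      simp [Generator.runFrom, h] at hr

/-- An uncontrollable event that the plant can execute stays within the prefix closure of a
controllable language. -/
theorem ControllableIn.append_mem_cl {E Q : Type} {G : Generator E Q} {K : Set (List E)}
    (hK : ControllableIn G K) {w : List E} {q q' : Q} {σ : E} (hw : w ∈ cl K)
    (hq : G.run w = some q) (hσ : σ ∉ G.controllable) (hs : G.step q σ = some q') :
    w ++ [σ] ∈ cl K := by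
  refine hK w σ hw hσ ?_
  change (G.run (w ++ [σ])).isSome
  rw [G.run_append_singleton hq, hs]
  rfl

section CompPlant

variable {n : ℕ} {SB ST Act : Type} (S : Fin n → Behavior SB Act) (T : Behavior ST Act)

theorem compPlant_step_request (hT : T.Deterministic) {t t' : ST} {a : Act}
    (b : Fin n → SB) (h : T.trans t a t') :
    (compPlant S T).step (t, b, none, none) (Sum.inl a) = some (t', b, some a, none) := by
  have hex : ∃ t', T.trans t a t' := ⟨t', h⟩
  have hc : hex.choose = t' := hT _ _ _ _ hex.choose_spec h
  simp only [compPlant, dif_pos hex, hc]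

theorem compPlant_step_delegated {t : ST} {b b' : Fin n → SB} {a : Act} {j : Fin n}
    (h : sysTrans S b a j b') :
    (compPlant S T).step (t, b, some a, some j) (Sum.inr (Sum.inr (b' j))) =
      some (t, b', none, none) := by
  have hb : Function.update b j (b' j) = b' := by
    funext i
    by_cases hi : i = j
    · subst hi; simp
    · simp [hi, h.2 i hi]
  simp [compPlant, h.1, hb]

theorem exists_index_of_compPlant_step_requested {t : ST} {b : Fin n → SB} {a : Act}
    {σ : PlantEvent SB Act n} {q : PlantState SB ST Act n}
    (h : (compPlant S T).step (t, b, some a, none) σ = some q) :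
    ∃ j, σ = Sum.inr (Sum.inl j) ∧ q = (t, b, some a, some j) := by
  rcases σ with a' | j | s
  · simp [compPlant] at h
  · exact ⟨j, rfl, by simpa [compPlant, eq_comm] using h⟩
  · simp [compPlant] at h

theorem exists_sysTrans_of_compPlant_step_delegated {t : ST} {b : Fin n → SB} {a : Act}
    {j : Fin n} {σ : PlantEvent SB Act n} {q : PlantState SB ST Act n}
    (h : (compPlant S T).step (t, b, some a, some j) σ = some q) :
    ∃ b', sysTrans S b a j b' := by
  rcases σ with a' | i | s
  · simp [compPlant] at h
  · simp [compPlant] at h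
  · by_cases hs : (S j).trans (b j) a s
    · exact ⟨Function.update b j s, by simpa using hs,
        fun i hi => (Function.update_of_ne hi s b).symm⟩
    · simp [compPlant, hs] at h

/-- The composition states reached within the closure of a controllable sublanguage of the marked
language form an nd-simulation. -/
theorem isNDSim_of_controllable (hT : T.Deterministic) {K : Set (List (PlantEvent SB Act n))}
    (hK : K ⊆ (compPlant S T).MLang) (hC : ControllableIn (compPlant S T) K) :
    IsNDSim T S fun t b => ∃ w ∈ cl K, (compPlant S T).run w = some (t, b, none, none) := by
  rintro t b ⟨w, hw, hrun⟩ a t' htrans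
  have hreq := compPlant_step_request S T hT b htrans
  have hw_req := hC.append_mem_cl hw hrun (by simp [compPlant]) hreq
  have hrun_req := ((compPlant S T).run_append_singleton hrun (Sum.inl a)).trans hreq
  obtain ⟨σ, q, hw_del, hdel⟩ :=
    exists_append_mem_cl hK hw_req hrun_req (by simp [compPlant])
  have hrun_del := ((compPlant S T).run_append_singleton hrun_req σ).trans hdel
  obtain ⟨j, rfl, rfl⟩ := exists_index_of_compPlant_step_requested S T hdel
  obtain ⟨_, _, _, hsucc⟩ :=
    exists_append_mem_cl hK hw_del hrun_del (by simp [compPlant])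
  refine ⟨j, exists_sysTrans_of_compPlant_step_delegated S T hsucc, fun b' hb' => ?_⟩
  have hstep := compPlant_step_delegated S T (t := t') hb'
  exact ⟨_, hC.append_mem_cl hw_del hrun_del (by simp [compPlant]) hstep,
    ((compPlant S T).run_append_singleton hrun_del _).trans hstep⟩

end CompPlant

/-- if `K↑_{S,T} ≠ ∅` then for every word `w ∈ K↑_{S,T}`, the
target component of the plant state reached by `w` is nd-simulated by its
system-state component. -/
theorem ndsim_along_supC {n : ℕ} {SB ST Act : Type}
    [Fintype SB] [Fintype ST] [Fintype Act]
    (S : Fin n → Behavior SB Act) (T : Behavior ST Act) (hT : T.Deterministic)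
    (hne : supC (compPlant S T) (compPlant S T).MLang ≠ ∅) :
    ∀ w ∈ supC (compPlant S T) (compPlant S T).MLang,
      ∀ g : PlantState SB ST Act n, (compPlant S T).run w = some g →
        NDSimulated T S g.1 g.2.1 := by
  rintro w ⟨K, ⟨hK, hC⟩, hw⟩ ⟨t, b, req, idx⟩ hg
  obtain ⟨q, hq, hm⟩ := hK hw
  obtain rfl : q = (t, b, req, idx) := Option.some.inj (hq.symm.trans hg)
  obtain ⟨rfl, rfl⟩ : req = none ∧ idx = none := hm
  exact ⟨_, isNDSim_of_controllable S T hT hK hC, w, ⟨[], by simpa using hw⟩, hg⟩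
end

section
/- Let S be a deterministic available system, T a deterministic target behavior, and let V be a nonblocking supervisor for the maximal composition plant Ĝ_{S,T} with Lm(V/Ĝ_{S,T}) = K̂↑ = supC(Lm(Ĝ_{S,T})). Then every exact composition P of the extracted target T*_{S,T} in S is induced by V: for every trace τ of T*_{S,T}, every (P,τ)-induced system history h ∈ H_{P,τ}, and the next requested transition of τ with action a, the delegation chosen by P belongs to V(word(τ, h)·θ), where θ is the unique transition of T on action a from the T-state reached by the actions of h. -/
open Classical

/-- When every event is controllable, every language is its own supremal controllable
sublanguage. -/
theorem supC_eq_self {E Q : Type} {G : Generator E Q} (hG : G.controllable = Set.univ)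
    (K : Set (List E)) : supC G K = K := by
  refine Set.Subset.antisymm (Set.sUnion_subset fun K' hK' => hK'.1)
    (Set.subset_sUnion_of_mem ⟨subset_rfl, fun w σ _ hσ => ?_⟩)
  simp [hG] at hσ

theorem CtrlLang.mem_of_snoc {E Q : Type} {G : Generator E Q} {V : List E → Set E}
    {w : List E} {σ : E} (h : CtrlLang G V (w ++ [σ])) : σ ∈ V w := by
  generalize hv : w ++ [σ] = v at h
  cases h with
  | nil => simp at hv
  | snoc _ _ hσ =>
    obtain ⟨rfl, rfl⟩ := List.append_singleton_inj.1 hv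
    exact hσ

theorem TInduced.validHist {n : ℕ} {SB ST' Act : Type} {S : Fin n → Behavior SB Act}
    {T' : Behavior ST' Act} {P : List (Step SB Act n) → ST' × Act × ST' → Fin n}
    {τ : Trace T'} {h : List (Step SB Act n)} (hh : TInduced S P τ h) : ValidHist S h := by
  induction hh with
  | nil => exact .nil
  | snoc _ _ _ htr ih => exact .snoc ih htr

theorem lastState_append_singleton {n : ℕ} {SB Act : Type} (S : Fin n → Behavior SB Act)
    (h : List (Step SB Act n)) (s : Step SB Act n) : lastState S (h ++ [s]) = s.2.2 := by
  simp [lastState]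

theorem MaxWordH.exists_of_snoc {n : ℕ} {SB ST Act : Type} {T : Behavior ST Act} {t tf : ST}
    {h : List (Step SB Act n)} {a : Act} {j : Fin n} {b : Fin n → SB}
    {w : List (MaxEvent ST Act n)} (hw : MaxWordH T t (h ++ [(a, j, b)]) w tf) :
    ∃ w' t₁, w = w' ++ [Sum.inl (t₁, a, tf), Sum.inr j] ∧ MaxWordH T t h w' t₁ ∧
      T.trans t₁ a tf := by
  induction h generalizing t w with
  | nil =>
    cases hw with
    | cons htr hrest =>
      cases hrest
      exact ⟨[], t, rfl, .nil, htr⟩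
  | cons s h ih =>
    cases hw with
    | cons htr hrest =>
      obtain ⟨w', t₁, rfl, hw', ht₁⟩ := ih hrest
      exact ⟨_, t₁, rfl, .cons htr hw', ht₁⟩

/-- Requesting an available target transition and delegating it to a behavior able to perform
its action mirrors the enacted-system transition in the maximal composition plant. -/
theorem maxPlant_runFrom_pair {n : ℕ} {SB ST Act : Type} {S : Fin n → Behavior SB Act}
    (hS : ∀ i, (S i).Deterministic) {T : Behavior ST Act} {t t' : ST} {a : Act}
    {b b' : Fin n → SB} {j : Fin n} (ht : T.trans t a t') (hb : sysTrans S b a j b') :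
    (maxPlant S T).runFrom (t, b, none) [Sum.inl (t, a, t'), Sum.inr j] =
      some (t', b', none) := by
  have hex : ∃ s', (S j).trans (b j) a s' := ⟨_, hb.1⟩
  have hchoose : hex.choose = b' j := hS j _ _ _ _ hex.choose_spec hb.1
  have hupd : Function.update b j (b' j) = b' :=
    Function.update_eq_iff.2 ⟨rfl, fun i hi => hb.2 i hi⟩
  simp [Generator.runFrom, maxPlant, ht, hex, hchoose, hupd]

theorem maxPlant_run_of_maxWordH {n : ℕ} {SB ST Act : Type} {S : Fin n → Behavior SB Act}
    (hS : ∀ i, (S i).Deterministic) {T : Behavior ST Act} {h : List (Step SB Act n)}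
    (hh : ValidHist S h) {w : List (MaxEvent ST Act n)} {tf : ST}
    (hw : MaxWordH T T.init h w tf) :
    (maxPlant S T).run w = some (tf, lastState S h, none) := by
  induction hh generalizing w tf with
  | nil => cases hw; rfl
  | snoc _ htr ih =>
    obtain ⟨w', t₁, rfl, hw', ht₁⟩ := hw.exists_of_snoc
    have hrun := ih hw'
    rw [Generator.run] at hrun ⊢
    rw [Generator.runFrom_append, hrun, lastState_append_singleton]
    exact maxPlant_runFrom_pair hS ht₁ htr

/-- completeness for SRTFs: if `V` is a nonblocking
supervisor for the maximal composition plant with `Lm(V/Ĝ_{S,T}) = K̂↑`, then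
every exact composition `P` of the extracted target `T*_{S,T}` in `S` is
induced by `V`: along every induced run, the chosen delegation belongs to
`V(word(τ,h)·θ)`, where `θ` is the unique `T`-transition on the next requested
action from the `T`-state reached by the actions of `h`. -/
theorem srtf_completeness {n : ℕ} {SB ST Act Y : Type}
    [Fintype SB] [Fintype ST] [Fintype Act] [Fintype Y]
    (S : Fin n → Behavior SB Act) (hS : ∀ i, (S i).Deterministic)
    (T : Behavior ST Act) (hT : T.Deterministic)
    (R : Generator (MaxEvent ST Act n) Y)
    (hL : R.Lang = cl (supC (maxPlant S T) (maxPlant S T).MLang))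
    (hLm : R.MLang = supC (maxPlant S T) (maxPlant S T).MLang)
    (V : List (MaxEvent ST Act n) → Set (MaxEvent ST Act n))
    (hV : IsSupervisor (maxPlant S T) V)
    (hnb : Nonblocking (maxPlant S T) V)
    (hm : mCtrlLang (maxPlant S T) V = supC (maxPlant S T) (maxPlant S T).MLang)
    (P : List (Step SB Act n) → Y × Act × Y → Fin n)
    (hP : TExactComposition S (extractedTarget T R) P) :
    ∀ (τ : Trace (extractedTarget T R)) (h : List (Step SB Act n)),
      TInduced S P τ h → (h.length : ℕ∞) < τ.len →
      ∀ (w : List (MaxEvent ST Act n)) (tf t' : ST),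
        MaxWordH T T.init h w tf → T.trans tf (τ.acts h.length) t' →
        Sum.inr (P h (τ.states h.length, τ.acts h.length, τ.states (h.length + 1))) ∈
          V (w ++ [Sum.inl (tf, τ.acts h.length, t')]) := by
  intro τ h hind hlen w tf t' hw ht'
  obtain ⟨b', hb'⟩ := hP τ h hind hlen
  have hrun := maxPlant_run_of_maxWordH hS hind.validHist hw
  have hmem : (w ++ [Sum.inl (tf, τ.acts h.length, t')]) ++
      [Sum.inr (P h (τ.states h.length, τ.acts h.length, τ.states (h.length + 1)))] ∈
      (maxPlant S T).MLang := by
    refine ⟨(t', b', none), ?_, rfl⟩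
    rw [Generator.run] at hrun ⊢
    rw [List.append_assoc, Generator.runFrom_append, hrun]
    exact maxPlant_runFrom_pair hS ht' hb'
  rw [← supC_eq_self (G := maxPlant S T) rfl (maxPlant S T).MLang, ← hm] at hmem
  exact CtrlLang.mem_of_snoc hmem.1
end

section
/- Let T be a deterministic target behavior and S an available system. If T̃1 and T̃2 are both supremal realizable target fragments of T in S, then T̃1 and T̃2 are simulation equivalent. -/
open Classical

/-- Simulation is transitive. -/
theorem Simulates.trans {S1 S2 S3 Act : Type} {B1 : Behavior S1 Act} {B2 : Behavior S2 Act}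
    {B3 : Behavior S3 Act} (h12 : Simulates B1 B2) (h23 : Simulates B2 B3) :
    Simulates B1 B3 := by
  obtain ⟨R, hR, hR0⟩ := h12
  obtain ⟨Q, hQ, hQ0⟩ := h23
  refine ⟨fun x z => ∃ y, R x y ∧ Q y z, ?_, _, hR0, hQ0⟩
  rintro x z ⟨y, hxy, hyz⟩ a x' hx
  obtain ⟨y', hy, hxy'⟩ := hR _ _ hxy _ _ hx
  obtain ⟨z', hz, hyz'⟩ := hQ _ _ hyz _ _ hy
  exact ⟨z', hz, y', hxy', hyz'⟩

/-- The nondeterministic choice of two behaviors: a fresh initial state `none` that offers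
the initial transitions of both, followed by the disjoint union of the two. -/
def Behavior.choice {S1 S2 Act : Type} (B1 : Behavior S1 Act) (B2 : Behavior S2 Act) :
    Behavior (Option (S1 ⊕ S2)) Act where
  init := none
  trans
    | none, a, some (Sum.inl s') => B1.trans B1.init a s'
    | none, a, some (Sum.inr s') => B2.trans B2.init a s'
    | some (Sum.inl s), a, some (Sum.inl s') => B1.trans s a s'
    | some (Sum.inr s), a, some (Sum.inr s') => B2.trans s a s'
    | _, _, _ => False

/-- The state of the left behavior encoded by a state of a choice (`d` off the left side). -/
def choiceLeft {S1 S2 : Type} (d : S1) : Option (S1 ⊕ S2) → S1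
  | some (Sum.inl s) => s
  | _ => d

/-- The state of the right behavior encoded by a state of a choice (`d` off the right side). -/
def choiceRight {S1 S2 : Type} (d : S2) : Option (S1 ⊕ S2) → S2
  | some (Sum.inr s) => s
  | _ => d

theorem simulates_choice_left {S1 S2 Act : Type} (B1 : Behavior S1 Act) (B2 : Behavior S2 Act) :
    Simulates B1 (B1.choice B2) := by
  refine ⟨fun s x => x = some (Sum.inl s) ∨ (s = B1.init ∧ x = none), ?_, Or.inr ⟨rfl, rfl⟩⟩
  rintro s x (rfl | ⟨rfl, rfl⟩) a s' hs
  · exact ⟨some (Sum.inl s'), hs, Or.inl rfl⟩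
  · exact ⟨some (Sum.inl s'), hs, Or.inl rfl⟩

theorem simulates_choice_right {S1 S2 Act : Type} (B1 : Behavior S1 Act) (B2 : Behavior S2 Act) :
    Simulates B2 (B1.choice B2) := by
  refine ⟨fun s x => x = some (Sum.inr s) ∨ (s = B2.init ∧ x = none), ?_, Or.inr ⟨rfl, rfl⟩⟩
  rintro s x (rfl | ⟨rfl, rfl⟩) a s' hs
  · exact ⟨some (Sum.inr s'), hs, Or.inl rfl⟩
  · exact ⟨some (Sum.inr s'), hs, Or.inl rfl⟩

/-- A behavior that simulates two behaviors simulates their choice. -/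
theorem choice_simulates {S1 S2 S Act : Type} {B1 : Behavior S1 Act} {B2 : Behavior S2 Act}
    {B : Behavior S Act} (h1 : Simulates B1 B) (h2 : Simulates B2 B) :
    Simulates (B1.choice B2) B := by
  obtain ⟨R, hR, hR0⟩ := h1
  obtain ⟨Q, hQ, hQ0⟩ := h2
  refine ⟨fun x t => match x with
    | none => t = B.init
    | some (Sum.inl s) => R s t
    | some (Sum.inr s) => Q s t, ?_, rfl⟩
  rintro (_ | s | s) t hst a (_ | s' | s') hs
  · exact hs.elim
  · cases hst
    exact hR _ _ hR0 _ _ hs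
  · cases hst
    exact hQ _ _ hQ0 _ _ hs
  · exact hs.elim
  · exact hR _ _ hst _ _ hs
  · exact hs.elim
  · exact hs.elim
  · exact hs.elim
  · exact hQ _ _ hst _ _ hs

/-- Realization transfers between traces with the same actions on which the two controllers
take the same delegations. -/
theorem TRealizes.of_agree {n : ℕ} {SB ST1 ST2 Act : Type} {S : Fin n → Behavior SB Act}
    {T1 : Behavior ST1 Act} {T2 : Behavior ST2 Act}
    {P1 : List (Step SB Act n) → ST1 × Act × ST1 → Fin n}
    {P2 : List (Step SB Act n) → ST2 × Act × ST2 → Fin n} {τ1 : Trace T1} {τ2 : Trace T2}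
    (hlen : τ1.len = τ2.len) (hacts : τ1.acts = τ2.acts)
    (hP : ∀ h (i : ℕ), (i : ℕ∞) < τ2.len →
      P2 h (τ2.states i, τ2.acts i, τ2.states (i + 1)) =
        P1 h (τ1.states i, τ1.acts i, τ1.states (i + 1)))
    (hr : TRealizes S P1 τ1) : TRealizes S P2 τ2 := by
  have key : ∀ h, TInduced S P2 τ2 h → TInduced S P1 τ1 h := by
    intro h hh
    induction hh with
    | nil => exact .nil
    | @snoc h j b _ hl hj hb ih =>
      rw [hP h _ hl] at hj
      rw [← hacts] at hb ⊢
      exact .snoc ih (hlen ▸ hl) hj hb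
  intro h hh hl
  rw [hP h _ hl, ← hacts]
  exact hr h (key h hh) (hlen ▸ hl)

/-- Along a trace of a choice, every state of positive index lies on the side
selected by the first transition. -/
theorem choice_trace_side {S1 S2 Act : Type} {B1 : Behavior S1 Act} {B2 : Behavior S2 Act}
    (τ : Trace (B1.choice B2)) :
    (∀ i : ℕ, (i : ℕ∞) < τ.len → ∃ s, τ.states (i + 1) = some (Sum.inl s)) ∨
      (∀ i : ℕ, (i : ℕ∞) < τ.len → ∃ s, τ.states (i + 1) = some (Sum.inr s)) := by
  have stay : ∀ i : ℕ, ((i + 1 : ℕ) : ℕ∞) < τ.len → (i : ℕ∞) < τ.len := fun i hi =>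
    lt_of_le_of_lt (by exact_mod_cast Nat.le_succ i) hi
  rcases h1 : τ.states 1 with _ | s | s
  · left
    intro i hi
    have h0 : ((0 : ℕ) : ℕ∞) < τ.len := lt_of_le_of_lt (by simp) hi
    have := τ.step 0 h0
    rw [τ.init_eq, h1] at this
    exact this.elim
  · left
    intro i
    induction i with
    | zero => exact fun _ => ⟨s, h1⟩
    | succ i ih =>
      intro hi
      obtain ⟨u, hu⟩ := ih (stay i hi)
      have := τ.step (i + 1) hi
      rw [hu] at this
      rcases h : τ.states (i + 1 + 1) with _ | v | v
      · exact (h ▸ this).elim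
      · exact ⟨v, rfl⟩
      · exact (h ▸ this).elim
  · right
    intro i
    induction i with
    | zero => exact fun _ => ⟨s, h1⟩
    | succ i ih =>
      intro hi
      obtain ⟨u, hu⟩ := ih (stay i hi)
      have := τ.step (i + 1) hi
      rw [hu] at this
      rcases h : τ.states (i + 1 + 1) with _ | v | v
      · exact (h ▸ this).elim
      · exact (h ▸ this).elim
      · exact ⟨v, rfl⟩

theorem choice_trans_left {S1 S2 Act : Type} {B1 : Behavior S1 Act} {B2 : Behavior S2 Act}
    {x y : Option (S1 ⊕ S2)} {a : Act} (h : (B1.choice B2).trans x a y)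
    (hy : ∃ s, y = some (Sum.inl s)) :
    B1.trans (choiceLeft B1.init x) a (choiceLeft B1.init y) := by
  obtain ⟨s, rfl⟩ := hy
  rcases x with _ | x | x
  · exact h
  · exact h
  · exact h.elim

theorem choice_trans_right {S1 S2 Act : Type} {B1 : Behavior S1 Act} {B2 : Behavior S2 Act}
    {x y : Option (S1 ⊕ S2)} {a : Act} (h : (B1.choice B2).trans x a y)
    (hy : ∃ s, y = some (Sum.inr s)) :
    B2.trans (choiceRight B2.init x) a (choiceRight B2.init y) := by
  obtain ⟨s, rfl⟩ := hy
  rcases x with _ | x | x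
  · exact h
  · exact h.elim
  · exact h

/-- Exact compositions of two targets combine into one of their choice. -/
theorem exists_composition_choice {n : ℕ} {SB ST1 ST2 Act : Type} {S : Fin n → Behavior SB Act}
    {T1 : Behavior ST1 Act} {T2 : Behavior ST2 Act}
    (h1 : ∃ P, TExactComposition S T1 P) (h2 : ∃ P, TExactComposition S T2 P) :
    ∃ P, TExactComposition S (T1.choice T2) P := by
  obtain ⟨P1, hP1⟩ := h1
  obtain ⟨P2, hP2⟩ := h2
  refine ⟨fun h θ => match θ.2.2 with
    | some (Sum.inr s') => P2 h (choiceRight T2.init θ.1, θ.2.1, s')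
    | y => P1 h (choiceLeft T1.init θ.1, θ.2.1, choiceLeft T1.init y), fun τ => ?_⟩
  rcases choice_trace_side τ with hside | hside
  · refine TRealizes.of_agree (τ1 := ⟨τ.len, fun i => choiceLeft T1.init (τ.states i), τ.acts,
      by rw [τ.init_eq]; rfl, fun i hi => choice_trans_left (τ.step i hi) (hside i hi)⟩)
      rfl rfl (fun h i hi => ?_) (hP1 _)
    obtain ⟨s, hs⟩ := hside i hi
    simp only [hs]
  · refine TRealizes.of_agree (τ1 := ⟨τ.len, fun i => choiceRight T2.init (τ.states i), τ.acts,
      by rw [τ.init_eq]; rfl, fun i hi => choice_trans_right (τ.step i hi) (hside i hi)⟩)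
      rfl rfl (fun h i hi => ?_) (hP2 _)
    obtain ⟨s, hs⟩ := hside i hi
    simp only [hs]
    rfl

/-- The choice of two realizable target fragments is a realizable target fragment. -/
theorem IsRTF.choice {n : ℕ} {SB ST ST1 ST2 Act : Type} {S : Fin n → Behavior SB Act}
    {T : Behavior ST Act} {T1 : Behavior ST1 Act} {T2 : Behavior ST2 Act}
    (h1 : IsRTF S T T1) (h2 : IsRTF S T T2) : IsRTF S T (T1.choice T2) :=
  ⟨choice_simulates h1.1 h2.1, exists_composition_choice h1.2 h2.2⟩

/-- uniqueness of SRTFs up to simulation equivalence: any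
two supremal realizable target fragments of `T` in `S` are simulation
equivalent. -/
theorem srtf_unique_up_to_simequiv {n : ℕ} {SB ST ST1 ST2 Act : Type}
    [Fintype SB] [Fintype ST] [Fintype Act]
    (S : Fin n → Behavior SB Act) (T : Behavior ST Act) (hT : T.Deterministic)
    (T1 : Behavior ST1 Act) (T2 : Behavior ST2 Act)
    (h1 : IsSRTF S T T1) (h2 : IsSRTF S T T2) :
    Simulates T1 T2 ∧ Simulates T2 T1 := by
  have hU := h1.1.choice h2.1
  exact ⟨(simulates_choice_left T1 T2).trans (h2.2 _ _ hU (simulates_choice_right T1 T2)),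
    (simulates_choice_right T1 T2).trans (h1.2 _ _ hU (simulates_choice_left T1 T2))⟩
end

section
/- Let T be a deterministic target behavior and S an available system. There exists an exact composition of T in S if and only if there exists a realizable target fragment of T in S that is simulation equivalent to T. -/
open Classical

/-- `B ≼ B` for every behavior `B`. -/
theorem Simulates.refl {State Act : Type} (B : Behavior State Act) : Simulates B B :=
  ⟨Eq, by rintro s _ rfl a s' h; exact ⟨s', h, rfl⟩, rfl⟩

/-- One step of the joint run of `T` and `T'` on the action `a`, choosing successors
related by `R`; the pair is left unchanged if there are none. -/
noncomputable def jointStep {ST ST' Act : Type} (T : Behavior ST Act) (T' : Behavior ST' Act)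
    (R : ST → ST' → Prop) (q : ST × ST') (a : Act) : ST × ST' :=
  if h : ∃ q' : ST × ST', T.trans q.1 a q'.1 ∧ T'.trans q.2 a q'.2 ∧ R q'.1 q'.2
  then h.choose else q

theorem jointStep_spec {ST ST' Act : Type} {T : Behavior ST Act} {T' : Behavior ST' Act}
    (hT : T.Deterministic) {R : ST → ST' → Prop}
    (hR : ∀ t s, R t s → ∀ a t', T.trans t a t' → ∃ s', T'.trans s a s' ∧ R t' s')
    {q : ST × ST'} (hq : R q.1 q.2) {a : Act} {t' : ST} (ht : T.trans q.1 a t') :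
    (jointStep T T' R q a).1 = t' ∧ T'.trans q.2 a (jointStep T T' R q a).2 ∧
      R (jointStep T T' R q a).1 (jointStep T T' R q a).2 := by
  obtain ⟨s', hs, hrs⟩ := hR _ _ hq a t' ht
  have h : ∃ q' : ST × ST', T.trans q.1 a q'.1 ∧ T'.trans q.2 a q'.2 ∧ R q'.1 q'.2 :=
    ⟨(t', s'), ht, hs, hrs⟩
  rw [jointStep, dif_pos h]
  exact ⟨hT _ _ _ _ h.choose_spec.1 ht, h.choose_spec.2⟩

/-- The joint run of `T` and `T'` on the actions of a system history. -/
noncomputable def jointRun {n : ℕ} {SB ST ST' Act : Type} (T : Behavior ST Act)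
    (T' : Behavior ST' Act) (R : ST → ST' → Prop) (h : List (Step SB Act n)) : ST × ST' :=
  h.foldl (fun q s => jointStep T T' R q s.1) (T.init, T'.init)

/-- The joint run of `T` and `T'` on a sequence of actions. -/
noncomputable def jointSeq {ST ST' Act : Type} (T : Behavior ST Act) (T' : Behavior ST' Act)
    (R : ST → ST' → Prop) (acts : ℕ → Act) : ℕ → ST × ST'
  | 0 => (T.init, T'.init)
  | i + 1 => jointStep T T' R (jointSeq T T' R acts i) (acts i)

theorem jointSeq_spec {ST ST' Act : Type} {T : Behavior ST Act} {T' : Behavior ST' Act}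
    (hT : T.Deterministic) {R : ST → ST' → Prop}
    (hR : ∀ t s, R t s → ∀ a t', T.trans t a t' → ∃ s', T'.trans s a s' ∧ R t' s')
    (hinit : R T.init T'.init) (τ : Trace T) (i : ℕ) (hi : (i : ℕ∞) ≤ τ.len) :
    (jointSeq T T' R τ.acts i).1 = τ.states i ∧
      R (jointSeq T T' R τ.acts i).1 (jointSeq T T' R τ.acts i).2 := by
  induction i with
  | zero => exact ⟨τ.init_eq.symm, hinit⟩
  | succ i ih =>
    have hlt : (i : ℕ∞) < τ.len := lt_of_lt_of_le (by exact_mod_cast Nat.lt_succ_self i) hi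
    obtain ⟨hs, hr⟩ := ih hlt.le
    have h := jointStep_spec hT hR hr (hs ▸ τ.step i hlt)
    exact ⟨h.1, h.2.2⟩

/-- The trace of `T'` that matches a trace of `T` along a simulation of `T` by `T'`. -/
noncomputable def Trace.transfer {ST ST' Act : Type} {T : Behavior ST Act}
    {T' : Behavior ST' Act} (hT : T.Deterministic) {R : ST → ST' → Prop}
    (hR : ∀ t s, R t s → ∀ a t', T.trans t a t' → ∃ s', T'.trans s a s' ∧ R t' s')
    (hinit : R T.init T'.init) (τ : Trace T) : Trace T' where
  len := τ.len
  states i := (jointSeq T T' R τ.acts i).2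
  acts := τ.acts
  init_eq := rfl
  step i hi := by
    obtain ⟨hs, hr⟩ := jointSeq_spec hT hR hinit τ i hi.le
    exact (jointStep_spec hT hR hr (hs ▸ τ.step i hi)).2.1

/-- The controller for `T` that issues the matching `T'`-requests to `P'`. -/
noncomputable def transferController {n : ℕ} {SB ST ST' Act : Type} (T : Behavior ST Act)
    (T' : Behavior ST' Act) (R : ST → ST' → Prop)
    (P' : List (Step SB Act n) → ST' × Act × ST' → Fin n) :
    List (Step SB Act n) → ST × Act × ST → Fin n :=
  fun h θ => P' h ((jointRun T T' R h).2, θ.2.1,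
    (jointStep T T' R (jointRun T T' R h) θ.2.1).2)

theorem TInduced.transfer {n : ℕ} {SB ST ST' Act : Type} {S : Fin n → Behavior SB Act}
    {T : Behavior ST Act} {T' : Behavior ST' Act} (hT : T.Deterministic)
    {R : ST → ST' → Prop}
    (hR : ∀ t s, R t s → ∀ a t', T.trans t a t' → ∃ s', T'.trans s a s' ∧ R t' s')
    (hinit : R T.init T'.init) {P' : List (Step SB Act n) → ST' × Act × ST' → Fin n}
    {τ : Trace T} {h : List (Step SB Act n)}
    (hh : TInduced S (transferController T T' R P') τ h) :
    TInduced S P' (τ.transfer hT hR hinit) h ∧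
      jointRun T T' R h = jointSeq T T' R τ.acts h.length := by
  induction hh with
  | nil => exact ⟨.nil, rfl⟩
  | @snoc h j b _ hlt hj hb ih =>
    obtain ⟨hi, hrun⟩ := ih
    refine ⟨TInduced.snoc (τ := τ.transfer hT hR hinit) hi hlt ?_ hb, ?_⟩
    · rw [hj, transferController, hrun]
      rfl
    · rw [List.length_append, List.length_singleton, jointSeq, ← hrun]
      simp [jointRun]

/-- Exact compositions transfer along simulations of a deterministic target. -/
theorem TExactComposition.transfer {n : ℕ} {SB ST ST' Act : Type}
    {S : Fin n → Behavior SB Act} {T : Behavior ST Act} {T' : Behavior ST' Act}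
    (hT : T.Deterministic) {R : ST → ST' → Prop}
    (hR : ∀ t s, R t s → ∀ a t', T.trans t a t' → ∃ s', T'.trans s a s' ∧ R t' s')
    (hinit : R T.init T'.init) {P' : List (Step SB Act n) → ST' × Act × ST' → Fin n}
    (hP : TExactComposition S T' P') :
    TExactComposition S T (transferController T T' R P') := by
  intro τ h hh hlt
  obtain ⟨hi, hrun⟩ := hh.transfer hT hR hinit
  rw [transferController, hrun]
  exact hP (τ.transfer hT hR hinit) h hi hlt

/-- there is an exact composition of the deterministic target
`T` in `S` iff there is a realizable target fragment of `T` in `S` that is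
simulation equivalent to `T`. -/
theorem exact_composition_iff_simequiv_rtf {n : ℕ} {SB ST Act : Type}
    [Fintype SB] [Fintype ST] [Fintype Act]
    (S : Fin n → Behavior SB Act) (T : Behavior ST Act) (hT : T.Deterministic) :
    (∃ P : List (Step SB Act n) → ST × Act × ST → Fin n, TExactComposition S T P) ↔
      ∃ (ST' : Type) (T' : Behavior ST' Act),
        IsRTF S T T' ∧ Simulates T' T ∧ Simulates T T' := by
  constructor
  · rintro ⟨P, hP⟩
    exact ⟨ST, T, ⟨.refl T, P, hP⟩, .refl T, .refl T⟩
  · rintro ⟨ST', T', ⟨-, P', hP'⟩, -, R, hR, hinit⟩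
    exact ⟨transferController T T' R P', hP'.transfer hT hR hinit⟩
end
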